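/- arXiv:math/0701849 — 4 statements merged into one kernel-verified Lean document; each statement's English description precedes it below -/
import Mathlib

section
/- Chain rule for the class G¹: let X, V, Z be real Banach spaces, F : X → V and G : V → Z. Assume F is continuous and there is DF : X → L(X,V) with HasLineDerivAt ℝ F (DF(x)h) x h for all x ∈ X, h ∈ X, and x ↦ DF(x)h continuous for each h; assume similarly G is continuous with DG : V → L(V,Z) such that HasLineDerivAt ℝ G (DG(v)k) v k for all v ∈ V, k ∈ V, and v ↦ DG(v)k continuous for each k. Then the composition G ∘ F satisfies: for every x ∈ X and h ∈ X, HasLineDerivAt ℝ (G ∘ F) (DG(F(x))(DF(x)h)) x h, and for every h ∈ X the map x ↦ DG(F(x))(DF(x)h) is continuous; i.e. G ∘ F ∈ G¹(X,Z) with ∇(G∘F)(x) = ∇G(F(x))∇F(x). -/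
open Filter Topology Set

/-- A strongly continuous family of operators on a Banach space is locally bounded in operator
norm. -/
theorem exists_eventually_norm_le_of_strongly_continuousAt {T V Z : Type*}
    [TopologicalSpace T] [FirstCountableTopology T]
    [NormedAddCommGroup V] [NormedSpace ℝ V] [CompleteSpace V]
    [NormedAddCommGroup Z] [NormedSpace ℝ Z] {A : T → V →L[ℝ] Z} {v : T}
    (hA : ∀ k, ContinuousAt (fun w => A w k) v) : ∃ C : ℝ, ∀ᶠ w in 𝓝 v, ‖A w‖ ≤ C := by
  by_contra! hC
  obtain ⟨b, hb⟩ := (𝓝 v).exists_antitone_basis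
  have hex : ∀ n : ℕ, ∃ w ∈ b n, (n : ℝ) < ‖A w‖ := fun n => by
    obtain ⟨w, hw, hwb⟩ := ((hC n).and_eventually (hb.mem n)).exists
    exact ⟨w, hwb, hw⟩
  choose w hwb hw using hex
  have hlim : Tendsto w atTop (𝓝 v) := hb.tendsto hwb
  obtain ⟨C, hbound⟩ := banach_steinhaus (g := fun n => A (w n)) fun k => by
    obtain ⟨C, hC⟩ := ((hA k).tendsto.comp hlim).norm.bddAbove_range
    exact ⟨C, fun n => hC ⟨n, rfl⟩⟩
  obtain ⟨n, hn⟩ := exists_nat_gt C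
  exact absurd (hbound n) (not_le.mpr (hn.trans (hw n)))

/-- A strongly continuous family of operators on a Banach space is jointly continuous. -/
theorem continuous_uncurry_of_strongly_continuous {T V Z : Type*}
    [TopologicalSpace T] [FirstCountableTopology T]
    [NormedAddCommGroup V] [NormedSpace ℝ V] [CompleteSpace V]
    [NormedAddCommGroup Z] [NormedSpace ℝ Z] {A : T → V →L[ℝ] Z}
    (hA : ∀ k, Continuous fun w => A w k) : Continuous fun p : T × V => A p.1 p.2 := by
  refine continuous_iff_continuousAt.mpr fun ⟨v, k⟩ => ?_
  obtain ⟨C, hC⟩ := exists_eventually_norm_le_of_strongly_continuousAt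
    fun k => (hA k).continuousAt (x := v)
  have hsmall : Tendsto (fun p : T × V => A p.1 (p.2 - k)) (𝓝 (v, k)) (𝓝 0) := by
    have hlim : Tendsto (fun p : T × V => C * ‖p.2 - k‖) (𝓝 (v, k)) (𝓝 0) := by
      have : Continuous fun p : T × V => C * ‖p.2 - k‖ := by fun_prop
      simpa using this.tendsto (v, k)
    refine squeeze_zero_norm' ?_ hlim
    filter_upwards [(continuous_fst.tendsto (v, k)).eventually hC] with p hp
    exact (A p.1).le_of_opNorm_le hp _
  have hfixed : Tendsto (fun p : T × V => A p.1 k) (𝓝 (v, k)) (𝓝 (A v k)) :=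
    ((hA k).comp continuous_fst).tendsto (v, k)
  simpa [ContinuousAt] using hsmall.add hfixed

/-- A function whose Gâteaux derivative is jointly continuous is Hadamard differentiable:
the difference quotients converge along varying directions. -/
theorem tendsto_slope_of_hasLineDerivAt {V Z : Type*} [NormedAddCommGroup V] [NormedSpace ℝ V]
    [NormedAddCommGroup Z] [NormedSpace ℝ Z] {G : V → Z} {DG : V → V →L[ℝ] Z}
    (hG : ∀ v k, HasLineDerivAt ℝ G (DG v k) v k)
    (hDG : Continuous fun p : V × V => DG p.1 p.2) (v k : V) :
    Tendsto (fun p : ℝ × V => p.1⁻¹ • (G (v + p.1 • p.2) - G v)) (𝓝[≠] 0 ×ˢ 𝓝 k)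
      (𝓝 (DG v k)) := by
  refine Metric.tendsto_nhds.mpr fun ε hε => ?_
  obtain ⟨δ, hδ, hclose⟩ := Metric.continuousAt_iff.mp (hDG.continuousAt (x := (v, k))) (ε / 2)
    (half_pos hε)
  have hsmall : ∀ᶠ p : ℝ × V in 𝓝[≠] 0 ×ˢ 𝓝 k, ‖p.1 • p.2‖ < δ := by
    have : ∀ᶠ p : ℝ × V in 𝓝 (0, k), ‖p.1 • p.2‖ < δ :=
      (by fun_prop : Continuous fun p : ℝ × V => ‖p.1 • p.2‖).continuousAt.eventually_lt
        continuousAt_const (by simpa using hδ)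
    rw [nhds_prod_eq] at this
    exact this.filter_mono (prod_mono nhdsWithin_le_nhds le_rfl)
  have hnear : ∀ᶠ p : ℝ × V in 𝓝[≠] 0 ×ˢ 𝓝 k, p.2 ∈ Metric.ball k δ :=
    tendsto_snd.eventually (Metric.ball_mem_nhds k hδ)
  have hne : ∀ᶠ p : ℝ × V in 𝓝[≠] 0 ×ˢ 𝓝 k, p.1 ≠ 0 :=
    tendsto_fst.eventually self_mem_nhdsWithin
  filter_upwards [hsmall, hnear, hne] with ⟨s, u⟩ hsu hu hs
  have hderiv : ∀ θ : ℝ, HasDerivAt (fun θ : ℝ => G (v + θ • s • u) - θ • s • DG v k)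
      (s • (DG (v + θ • s • u) u - DG v k)) θ := fun θ => by
    have hline : HasDerivAt (fun θ : ℝ => G (v + θ • s • u)) (DG (v + θ • s • u) (s • u)) θ := by
      have := hG (v + θ • s • u) (s • u)
      rw [HasLineDerivAt, ← sub_self θ] at this
      have := this.comp_sub_const θ θ
      refine this.congr_of_eventuallyEq (Eventually.of_forall fun t => ?_)
      simp only [sub_smul]
      congr 1
      abel
    simpa [smul_sub] using hline.fun_sub ((hasDerivAt_id θ).smul_const (s • DG v k))
  have hmvt := norm_image_sub_le_of_norm_deriv_le_segment_01' (C := |s| * (ε / 2))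
    (fun θ _ => (hderiv θ).hasDerivWithinAt) fun θ hθ => by
      rw [norm_smul, Real.norm_eq_abs, ← dist_eq_norm]
      refine mul_le_mul_of_nonneg_left (hclose (x := (v + θ • s • u, u)) ?_).le (abs_nonneg s)
      refine max_lt ?_ hu
      rw [dist_self_add_left, norm_smul, Real.norm_of_nonneg hθ.1]
      exact (mul_le_of_le_one_left (norm_nonneg _) hθ.2.le).trans_lt hsu
  have hslope : s⁻¹ • (G (v + s • u) - G v) - DG v k
      = s⁻¹ • (G (v + s • u) - s • DG v k - G v) := by
    rw [sub_right_comm, smul_sub _ _ (s • _), inv_smul_smul₀ hs]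
  simp only [one_smul, zero_smul, add_zero, sub_zero] at hmvt
  rw [dist_eq_norm, hslope, norm_smul, norm_inv, Real.norm_eq_abs]
  calc |s|⁻¹ * ‖G (v + s • u) - s • DG v k - G v‖ ≤ |s|⁻¹ * (|s| * (ε / 2)) := by gcongr
    _ = ε / 2 := inv_mul_cancel_left₀ (abs_ne_zero.mpr hs) _
    _ < ε := half_lt_self hε

/-- Chain rule for the class `G¹`: if `F : X → V` and `G : V → Z` are continuous, Gâteaux
differentiable with continuous linear Gâteaux derivatives `DF`, `DG` that are strongly
continuous, then `G ∘ F` is Gâteaux differentiable with derivative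
`∇(G ∘ F)(x) = DG (F x) ∘ DF x`, which is again strongly continuous in `x`. -/
theorem gateaux_chain_rule
    {X V Z : Type*} [NormedAddCommGroup X] [NormedSpace ℝ X] [CompleteSpace X]
    [NormedAddCommGroup V] [NormedSpace ℝ V] [CompleteSpace V]
    [NormedAddCommGroup Z] [NormedSpace ℝ Z] [CompleteSpace Z]
    (F : X → V) (G : V → Z) (DF : X → X →L[ℝ] V) (DG : V → V →L[ℝ] Z)
    (hFc : Continuous F)
    (hFd : ∀ (x h : X), HasLineDerivAt ℝ F (DF x h) x h)
    (hFs : ∀ h : X, Continuous fun x : X => DF x h)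
    (hGc : Continuous G)
    (hGd : ∀ (v k : V), HasLineDerivAt ℝ G (DG v k) v k)
    (hGs : ∀ k : V, Continuous fun v : V => DG v k) :
    (∀ (x h : X), HasLineDerivAt ℝ (G ∘ F) (DG (F x) (DF x h)) x h) ∧
      (∀ h : X, Continuous fun x : X => DG (F x) (DF x h)) := by
  have hjoint := continuous_uncurry_of_strongly_continuous hGs
  refine ⟨fun x h => ?_, fun h => hjoint.comp (hFc.prodMk (hFs h))⟩
  rw [hasLineDerivAt_iff_tendsto_slope_zero]
  have hlim : Tendsto (fun t : ℝ => (t, t⁻¹ • (F (x + t • h) - F x))) (𝓝[≠] 0)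
      (𝓝[≠] 0 ×ˢ 𝓝 (DF x h)) :=
    tendsto_id.prodMk (hFd x h).tendsto_slope_zero
  refine ((tendsto_slope_of_hasLineDerivAt hGd hjoint (F x) (DF x h)).comp hlim).congr' ?_
  filter_upwards [self_mem_nhdsWithin] with t ht
  simp [smul_inv_smul₀ ht]
end

section
/- Sufficient condition for Gâteaux differentiability: let X and V be real Banach spaces, F : X → V, and g : X → X → V such that (i) for every x ∈ X and every h ∈ X, HasLineDerivAt ℝ F (g x h) x h (the directional derivative of F at x in direction h exists and equals g x h); (ii) for every h ∈ X, the map x ↦ g x h is continuous from X to V; (iii) for every x ∈ X, the map h ↦ g x h is continuous from X to V. Then F is continuous and, for every x ∈ X, the map h ↦ g x h is ℝ-linear (so that, together with (iii), it defines a continuous linear operator ∇F(x) ∈ L(X,V) and F belongs to G¹(X,V)). -/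
open Filter Topology

/-- Mean value inequality along a segment for a map with directional derivatives. -/
theorem norm_sub_sub_le_of_hasLineDerivAt {X V : Type*} [NormedAddCommGroup X] [NormedSpace ℝ X]
    [NormedAddCommGroup V] [NormedSpace ℝ V] {F : X → V} {F' : X → V} {a v : X} {w : V} {C : ℝ}
    (hF : ∀ x, HasLineDerivAt ℝ F (F' x) x v)
    (hC : ∀ t ∈ Set.Ico (0 : ℝ) 1, ‖F' (a + t • v) - w‖ ≤ C) :
    ‖F (a + v) - F a - w‖ ≤ C := by
  have hd : ∀ t : ℝ, HasDerivAt (fun t : ℝ => F (a + t • v) - t • w) (F' (a + t • v) - w) t := by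
    intro t
    have h := hF (a + t • v)
    rw [HasLineDerivAt, ← sub_self t] at h
    have h' := h.comp_sub_const t t
    have hw : HasDerivAt (fun t : ℝ => t • w) w t := by
      simpa using (hasDerivAt_id t).smul_const w
    refine HasDerivAt.sub (h'.congr_of_eventuallyEq (.of_forall fun s => ?_)) hw
    simp only [add_assoc, ← add_smul, add_sub_cancel]
  have h := norm_image_sub_le_of_norm_deriv_le_segment_01'
    (fun t _ => (hd t).hasDerivWithinAt) hC
  simpa [sub_right_comm] using h

theorem HasLineDerivAt.add_direction {X V : Type*} [NormedAddCommGroup X] [NormedSpace ℝ X]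
    [NormedAddCommGroup V] [NormedSpace ℝ V] {F : X → V} {F' : X → V} {v : V} {x h k : X}
    (hh : HasLineDerivAt ℝ F v x h) (hk : ∀ y, HasLineDerivAt ℝ F (F' y) y k)
    (hc : ContinuousAt F' x) : HasLineDerivAt ℝ F (v + F' x) x (h + k) := by
  have hdiff : HasDerivAt (fun s : ℝ => F (x + s • h + s • k) - F (x + s • h)) (F' x) 0 := by
    rw [hasDerivAt_iff_isLittleO_nhds_zero, Asymptotics.isLittleO_iff]
    intro ε hε
    obtain ⟨δ, hδ, hball⟩ := Metric.continuousAt_iff.1 hc ε hε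
    have hlim : Tendsto (fun s : ℝ => |s| * (‖h‖ + ‖k‖)) (𝓝 0) (𝓝 0) := by
      have : Continuous fun s : ℝ => |s| * (‖h‖ + ‖k‖) := by fun_prop
      simpa using this.tendsto 0
    filter_upwards [hlim.eventually_lt_const hδ] with s hs
    simp only [zero_add, zero_smul, add_zero, sub_self, sub_zero]
    refine norm_sub_sub_le_of_hasLineDerivAt (F' := fun y => s • F' y)
      (fun y => (hk y).smul s) fun t ht => ?_
    rw [← smul_sub, norm_smul, mul_comm]
    refine mul_le_mul_of_nonneg_right ?_ (norm_nonneg s)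
    rw [← dist_eq_norm]
    refine (hball ?_).le
    rw [dist_eq_norm, add_assoc, add_sub_cancel_left]
    refine lt_of_le_of_lt ?_ hs
    calc ‖s • h + t • s • k‖ ≤ |s| * ‖h‖ + |t| * (|s| * ‖k‖) := by
          simpa [norm_smul] using norm_add_le (s • h) (t • s • k)
      _ ≤ |s| * ‖h‖ + 1 * (|s| * ‖k‖) := by
          gcongr
          rw [abs_of_nonneg ht.1]
          exact ht.2.le
      _ = |s| * (‖h‖ + ‖k‖) := by ring
  refine (HasDerivAt.add hh hdiff).congr_of_eventuallyEq (.of_forall fun s => ?_)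
  simp [smul_add, add_assoc]

/-- A strongly continuous family of operators on a Banach space is locally bounded. -/
theorem exists_eventually_norm_le_of_forall_continuousAt {Y X V : Type*} [TopologicalSpace Y]
    [FirstCountableTopology Y] [NormedAddCommGroup X] [NormedSpace ℝ X] [CompleteSpace X]
    [NormedAddCommGroup V] [NormedSpace ℝ V] {G : Y → X →L[ℝ] V} {x : Y}
    (hG : ∀ h, ContinuousAt (fun y => G y h) x) : ∃ C, ∀ᶠ y in 𝓝 x, ‖G y‖ ≤ C := by
  by_contra! hcon
  obtain ⟨b, hb⟩ := (𝓝 x).exists_antitone_basis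
  have hex : ∀ n : ℕ, ∃ y ∈ b n, (n : ℝ) < ‖G y‖ := fun n => by
    obtain ⟨y, hy, hyb⟩ := ((hcon n).and_eventually (hb.mem n)).exists
    exact ⟨y, hyb, by simpa using hy⟩
  choose y hyb hy using hex
  have hbound : ∀ h, ∃ C, ∀ n, ‖G (y n) h‖ ≤ C := fun h => by
    obtain ⟨C, hC⟩ := ((hG h).tendsto.comp (hb.tendsto hyb)).norm.bddAbove_range
    exact ⟨C, fun n => hC ⟨n, rfl⟩⟩
  obtain ⟨C, hC⟩ := banach_steinhaus hbound
  obtain ⟨n, hn⟩ := exists_nat_gt C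
  exact (hn.trans (hy n)).not_ge (hC n)

theorem continuous_of_hasLineDerivAt {X V : Type*} [NormedAddCommGroup X] [NormedSpace ℝ X]
    [CompleteSpace X] [NormedAddCommGroup V] [NormedSpace ℝ V] {F : X → V} {G : X → X →L[ℝ] V}
    (hF : ∀ x h, HasLineDerivAt ℝ F (G x h) x h) (hG : ∀ h, Continuous fun x => G x h) :
    Continuous F := by
  refine continuous_iff_continuousAt.2 fun x => ?_
  obtain ⟨C, hC⟩ := exists_eventually_norm_le_of_forall_continuousAt
    fun h => (hG h).continuousAt (x := x)
  obtain ⟨δ, hδ, hball⟩ := Metric.eventually_nhds_iff.1 hC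
  refine continuousAt_of_locally_lipschitz hδ C fun y hy => ?_
  rw [dist_eq_norm] at hy
  have h := norm_sub_sub_le_of_hasLineDerivAt (a := x) (v := y - x) (w := 0)
    (C := C * ‖y - x‖) (fun z => hF z (y - x)) fun t ht => by
      rw [sub_zero]
      refine (G _).le_of_opNorm_le (hball ?_) _
      rw [dist_eq_norm, add_sub_cancel_left, norm_smul, Real.norm_of_nonneg ht.1]
      exact (mul_le_of_le_one_left (norm_nonneg _) ht.2.le).trans_lt hy
  simpa [dist_eq_norm] using h

/-- Sufficient condition for Gâteaux differentiability: if all directional derivatives of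
`F : X → V` exist and are given by `g x h`, with `x ↦ g x h` continuous for every `h` and
`h ↦ g x h` continuous for every `x`, then `F` is continuous and `h ↦ g x h` is linear
(hence defines a continuous linear Gâteaux derivative, so `F ∈ G¹(X,V)`). -/
theorem gateaux_sufficient_condition
    {X V : Type*} [NormedAddCommGroup X] [NormedSpace ℝ X] [CompleteSpace X]
    [NormedAddCommGroup V] [NormedSpace ℝ V] [CompleteSpace V]
    (F : X → V) (g : X → X → V)
    (h1 : ∀ (x h : X), HasLineDerivAt ℝ F (g x h) x h)
    (h2 : ∀ h : X, Continuous fun x : X => g x h)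
    (h3 : ∀ x : X, Continuous fun h : X => g x h) :
    Continuous F ∧ ∀ x : X, IsLinearMap ℝ (g x) := by
  have hlin : ∀ x : X, IsLinearMap ℝ (g x) := fun x =>
    { map_add := fun h k =>
        (h1 x (h + k)).unique ((h1 x h).add_direction (fun y => h1 y k) (h2 k).continuousAt)
      map_smul := fun c h => (h1 x (c • h)).unique ((h1 x h).smul c) }
  exact ⟨continuous_of_hasLineDerivAt
    (G := fun x => { toLinearMap := (hlin x).mk' (g x), cont := h3 x }) h1 h2, hlin⟩
end

section
/- Parametric sufficient condition for partial Gâteaux differentiability: let X, Y, V be real Banach spaces and F : X × Y → V a continuous map, and g : X → Y → X → V such that (i) for every (x,y) ∈ X × Y and every h ∈ X, HasLineDerivAt ℝ (fun x' => F(x',y)) (g x y h) x h (the partial directional derivative of F in the first variable at (x,y) in direction h exists and equals g x y h); (ii) for every h ∈ X, the map (x,y) ↦ g x y h is continuous from X × Y to V; (iii) for every (x,y) ∈ X × Y, the map h ↦ g x y h is continuous from X to V. Then for every (x,y) ∈ X × Y, the map h ↦ g x y h is ℝ-linear (so that it defines a continuous linear operator ∇ₓF(x,y) ∈ L(X,V),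 i.e. F belongs to G^{1,0}(X × Y, V)). -/
open Topology in
/-- If `f` has a line derivative at `x` in the direction `h`, and has line derivatives in the
direction `k` near `x` that are continuous at `x`, then its line derivatives at `x` add up in the
direction `h + k`. -/
theorem HasLineDerivAt.add_of_continuousAt
    {E G : Type*} [NormedAddCommGroup E] [NormedSpace ℝ E]
    [NormedAddCommGroup G] [NormedSpace ℝ G]
    {f f' : E → G} {a : G} {x h k : E} (hf : HasLineDerivAt ℝ f a x h)
    (hk : ∀ᶠ z in 𝓝 x, HasLineDerivAt ℝ f (f' z) z k) (hf' : ContinuousAt f' x) :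
    HasLineDerivAt ℝ f (a + f' x) x (h + k) := by
  have key : HasDerivAt (fun s : ℝ => f (x + s • (h + k)) - f (x + s • h)) (f' x) 0 := by
    rw [hasDerivAt_iff_isLittleO_nhds_zero, Asymptotics.isLittleO_iff]
    intro ε hε
    have hclose : ∀ᶠ z in 𝓝 x, ‖f' z - f' x‖ ≤ ε := by
      filter_upwards [hf'.eventually (Metric.closedBall_mem_nhds (f' x) hε)] with z hz
      simpa [dist_eq_norm] using hz
    obtain ⟨r, hr, hball⟩ := Metric.eventually_nhds_iff_ball.1 (hk.and hclose)
    have hmem (v : E) : ∀ᶠ s : ℝ in 𝓝 0, x + s • v ∈ Metric.ball x r := by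
      have hcont : ContinuousAt (fun s : ℝ => x + s • v) 0 := by fun_prop
      exact hcont.eventually_mem (by simpa using Metric.ball_mem_nhds x hr)
    filter_upwards [hmem h, hmem (h + k)] with s hs₁ hs₂
    have hseg (t : ℝ) (ht : t ∈ Set.Icc (0 : ℝ) 1) :
        x + s • h + t • s • k ∈ Metric.ball x r := by
      have := (convex_ball x r).add_smul_sub_mem hs₁ hs₂ ht
      convert this using 3
      module
    have hderiv (t : ℝ) (ht : t ∈ Set.Icc (0 : ℝ) 1) :
        HasDerivWithinAt (fun t : ℝ => f (x + s • h + t • s • k) - t • s • f' x)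
          (s • f' (x + s • h + t • s • k) - (1 : ℝ) • s • f' x) (Set.Icc 0 1) t := by
      have hline : HasDerivAt (fun τ : ℝ => f (x + s • h + t • s • k + τ • s • k))
          (s • f' (x + s • h + t • s • k)) (t - t) := by
        rw [sub_self]
        exact (hball _ (hseg t ht)).1.smul s
      have hshift := hline.comp_sub_const t t
      refine HasDerivAt.hasDerivWithinAt (HasDerivAt.sub ?_ ((hasDerivAt_id t).smul_const _))
      convert hshift using 3 with τ
      module
    have hbound := (convex_Icc (0 : ℝ) 1).norm_image_sub_le_of_norm_hasDerivWithin_le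
      (C := ε * ‖s‖) hderiv (fun t ht => by
        rw [one_smul, ← smul_sub, norm_smul, mul_comm]
        gcongr
        exact (hball _ (hseg t ht)).2)
      (Set.left_mem_Icc.2 zero_le_one) (Set.right_mem_Icc.2 zero_le_one)
    rw [sub_zero, norm_one, mul_one] at hbound
    convert hbound using 2
    simp only [zero_add, zero_smul, add_zero, one_smul, sub_zero, smul_add, add_assoc, sub_self]
    abel
  have hsum := HasDerivAt.add hf key
  unfold HasLineDerivAt
  convert hsum using 1
  ext s
  simp

/-- Parametric sufficient condition for partial Gâteaux differentiability: if
`F : X × Y → V` is continuous, the partial directional derivatives in the first variable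
exist and equal `g x y h`, with `(x,y) ↦ g x y h` continuous for every `h` and
`h ↦ g x y h` continuous for every `(x,y)`, then `h ↦ g x y h` is linear at every point
(hence defines a continuous linear partial Gâteaux derivative, so `F ∈ G^{1,0}(X × Y, V)`). -/
theorem partial_gateaux_sufficient_condition
    {X Y V : Type*} [NormedAddCommGroup X] [NormedSpace ℝ X] [CompleteSpace X]
    [NormedAddCommGroup Y] [NormedSpace ℝ Y] [CompleteSpace Y]
    [NormedAddCommGroup V] [NormedSpace ℝ V] [CompleteSpace V]
    (F : X × Y → V) (hF : Continuous F) (g : X → Y → X → V)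
    (h1 : ∀ (x : X) (y : Y) (h : X),
      HasLineDerivAt ℝ (fun x' : X => F (x', y)) (g x y h) x h)
    (h2 : ∀ h : X, Continuous fun p : X × Y => g p.1 p.2 h)
    (h3 : ∀ (x : X) (y : Y), Continuous fun h : X => g x y h) :
    ∀ (x : X) (y : Y), IsLinearMap ℝ (g x y) := by
  intro x y
  refine ⟨fun h k => ?_, fun c h => (h1 x y (c • h)).unique ((h1 x y h).smul c)⟩
  have hcont : Continuous fun z : X => g z y k :=
    (h2 k).comp (Continuous.prodMk_left y)
  exact (h1 x y (h + k)).unique ((h1 x y h).add_of_continuousAt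
    (.of_forall fun z => h1 z y k) hcont.continuousAt)
end

section
/- Abstract exponential moment bound: let (Ω, F, P) be a probability space, A : Ω → ℝ a nonnegative random variable and N ≥ 0 a constant such that E[A^n] ≤ n! · N^{2n} for every integer n ≥ 1. Then for every α ∈ (0,1) and every p ≥ 0, E[exp(p · A^α)] ≤ Σ_{n≥0} pⁿ N^{2nα} / (n!)^{1−α} < +∞; in particular exp(p·A^α) is integrable. -/
open MeasureTheory

/-- Jensen's inequality for the concave power `x ↦ x ^ α`, in `ℝ≥0∞`. -/
theorem lintegral_rpow_le_rpow_lintegral {Ω : Type*} [MeasurableSpace Ω] {μ : Measure Ω}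
    [IsProbabilityMeasure μ] {f : Ω → ENNReal} (hf : AEMeasurable f μ) {α : ℝ}
    (hα : 0 < α) (hα1 : α ≤ 1) :
    ∫⁻ ω, f ω ^ α ∂μ ≤ (∫⁻ ω, f ω ∂μ) ^ α := by
  have h := eLpNorm'_le_eLpNorm'_of_exponent_le hα hα1 μ hf.aestronglyMeasurable
  simp only [eLpNorm', enorm_eq_self, ENNReal.rpow_one, one_div_one] at h
  rwa [one_div, ENNReal.rpow_inv_le_iff hα] at h

/-- The series `∑ xⁿ / (n!)^β` converges for every `β > 0`. -/
theorem summable_pow_div_factorial_rpow {β : ℝ} (hβ : 0 < β) (x : ℝ) :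
    Summable fun n : ℕ => x ^ n / (Nat.factorial n : ℝ) ^ β := by
  have hlim : Filter.Tendsto (fun n : ℕ => ((n + 1 : ℕ) : ℝ) ^ β) Filter.atTop Filter.atTop :=
    (tendsto_rpow_atTop hβ).comp
      (tendsto_natCast_atTop_atTop.comp (Filter.tendsto_add_atTop_nat 1))
  refine summable_of_ratio_norm_eventually_le (r := 1 / 2) (by norm_num) ?_
  filter_upwards [hlim.eventually_ge_atTop (2 * |x|)] with n hn
  have hn0 : 0 < ((n + 1 : ℕ) : ℝ) ^ β := by positivity
  have hf0 : 0 < (Nat.factorial n : ℝ) ^ β := by positivity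
  rw [Nat.factorial_succ, Nat.cast_mul, Real.mul_rpow (by positivity) (by positivity), pow_succ',
    mul_div_mul_comm, norm_mul]
  gcongr
  rw [norm_div, Real.norm_eq_abs, Real.norm_of_nonneg hn0.le, div_le_iff₀ hn0]
  linarith

/-- Abstract exponential moment bound: if `A ≥ 0` satisfies `E[Aⁿ] ≤ n! · N^{2n}` for all
`n ≥ 1`, then for every `α ∈ (0,1)` and `p ≥ 0`,
`E[exp(p · A^α)] ≤ Σ_{n ≥ 0} pⁿ N^{2nα} / (n!)^{1-α} < +∞`; in particular `exp(p · A^α)`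
is integrable. -/
theorem exponential_moment_from_moment_bounds
    {Ω : Type*} [MeasurableSpace Ω] (μ : Measure Ω) [IsProbabilityMeasure μ]
    (A : Ω → ℝ) (hA : Measurable A) (hA0 : ∀ ω, 0 ≤ A ω)
    (N : ℝ) (hN : 0 ≤ N)
    (hmom : ∀ n : ℕ, 1 ≤ n →
      ∫⁻ ω, ENNReal.ofReal ((A ω) ^ n) ∂μ
        ≤ ENNReal.ofReal (((Nat.factorial n : ℕ) : ℝ) * N ^ (2 * n))) :
    ∀ α ∈ Set.Ioo (0 : ℝ) 1, ∀ p : ℝ, 0 ≤ p →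
      (∫⁻ ω, ENNReal.ofReal (Real.exp (p * (A ω) ^ α)) ∂μ
          ≤ ∑' n : ℕ, ENNReal.ofReal
              (p ^ n * N ^ (2 * (n : ℝ) * α) / ((Nat.factorial n : ℝ) ^ (1 - α)))) ∧
        (∑' n : ℕ, ENNReal.ofReal
            (p ^ n * N ^ (2 * (n : ℝ) * α) / ((Nat.factorial n : ℝ) ^ (1 - α))) < ⊤) ∧
        Integrable (fun ω => Real.exp (p * (A ω) ^ α)) μ := by
  rintro α ⟨hα0, hα1⟩ p hp
  have hterm (n : ℕ) : p ^ n * N ^ (2 * (n : ℝ) * α) / (Nat.factorial n : ℝ) ^ (1 - α)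
      = p ^ n / Nat.factorial n * ((Nat.factorial n : ℝ) * N ^ (2 * n)) ^ α := by
    have hfact : (0 : ℝ) < Nat.factorial n := by positivity
    rw [Real.mul_rpow hfact.le (by positivity), Real.rpow_sub hfact, Real.rpow_one,
      ← Real.rpow_natCast N, ← Real.rpow_mul hN]
    push_cast
    field_simp
  have hmoment (n : ℕ) : ∫⁻ ω, ENNReal.ofReal (A ω ^ n) ∂μ
      ≤ ENNReal.ofReal ((Nat.factorial n : ℝ) * N ^ (2 * n)) := by
    rcases Nat.eq_zero_or_pos n with rfl | hn
    · simp
    · exact hmom n hn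
  have hexp (ω : Ω) : ENNReal.ofReal (Real.exp (p * A ω ^ α))
      = ∑' n : ℕ, ENNReal.ofReal (p ^ n / Nat.factorial n) * ENNReal.ofReal (A ω ^ n) ^ α := by
    have hA' := hA0 ω
    have hx : 0 ≤ p * A ω ^ α := by positivity
    rw [Real.exp_eq_exp_ℝ, NormedSpace.exp_eq_tsum_div,
      ENNReal.ofReal_tsum_of_nonneg (fun n => by positivity) (Real.summable_pow_div_factorial _)]
    congr 1 with n
    rw [ENNReal.ofReal_rpow_of_nonneg (by positivity) hα0.le,
      ← ENNReal.ofReal_mul (by positivity), mul_pow, Real.rpow_pow_comm hA', mul_div_right_comm]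
  have hbound : ∫⁻ ω, ENNReal.ofReal (Real.exp (p * A ω ^ α)) ∂μ
      ≤ ∑' n : ℕ, ENNReal.ofReal
          (p ^ n * N ^ (2 * (n : ℝ) * α) / (Nat.factorial n : ℝ) ^ (1 - α)) := by
    simp_rw [hexp]
    rw [lintegral_tsum fun n => by fun_prop]
    refine ENNReal.tsum_le_tsum fun n => ?_
    rw [lintegral_const_mul _ (by fun_prop), hterm, ENNReal.ofReal_mul (by positivity),
      ← ENNReal.ofReal_rpow_of_nonneg (by positivity) hα0.le]
    gcongr
    exact (lintegral_rpow_le_rpow_lintegral (by fun_prop) hα0 hα1.le).trans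
      (ENNReal.rpow_le_rpow (hmoment n) hα0.le)
  have hfinite : ∑' n : ℕ, ENNReal.ofReal
      (p ^ n * N ^ (2 * (n : ℝ) * α) / (Nat.factorial n : ℝ) ^ (1 - α)) < ⊤ := by
    refine Summable.tsum_ofReal_lt_top ?_
    convert summable_pow_div_factorial_rpow (sub_pos.2 hα1) (p * N ^ (2 * α)) using 3 with n
    rw [mul_pow, ← Real.rpow_mul_natCast hN]
    ring_nf
  refine ⟨hbound, hfinite,
    (Real.measurable_exp.comp ((hA.pow_const α).const_mul p)).aestronglyMeasurable, ?_⟩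
  rw [hasFiniteIntegral_iff_ofReal (.of_forall fun ω => (Real.exp_pos _).le)]
  exact hbound.trans_lt hfinite
end
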